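/- Let p ≥ 1 be a real number and let c be a real number with 0 ≤ c < √8. Then there is no sequence (y_i)_{i≥0} of positive real numbers satisfying y_{i+2} ≤ (c/√(p+1) + 2)·y_{i+1} - (2/(p+1) + c/√(p+1) + 1)·y_i for all i ≥ 0. -/

import Mathlib

theorem aux_rec (a b : ℝ) (h : a ^ 2 < 4 * b) (y : ℕ → ℝ) (hy : ∀ i, 0 < y i)
    (hr : ∀ i, y (i + 2) ≤ a * y (i + 1) - b * y i) : False := by
  obtain ⟨r, hrdef⟩ : ∃ r : ℕ → ℝ, ∀ i, r i = y (i + 1) / y i := ⟨_, fun _ => rfl⟩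
  have hpos : ∀ i, 0 < r i := fun i => by rw [hrdef]; exact div_pos (hy _) (hy _)
  have hstep : ∀ i, r (i + 1) * r i ≤ a * r i - b := by
    intro i
    have h0 := hy i
    have h1 := hy (i + 1)
    have e : r (i + 1) * r i = y (i + 2) / y i := by
      rw [hrdef, hrdef]; field_simp
    have e2 : a * r i - b = (a * y (i + 1) - b * y i) / y i := by
      rw [hrdef]; field_simp
    rw [e, e2]
    exact div_le_div_of_nonneg_right (hr i) h0.le
  have hdel : 0 < b - a ^ 2 / 4 := by linarith
  have hdec : ∀ i, (r i - r (i + 1)) * r i ≥ b - a ^ 2 / 4 := by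
    intro i
    nlinarith [hstep i, sq_nonneg (r i - a / 2)]
  have hR := hpos 0
  have heps : 0 < (b - a ^ 2 / 4) / r 0 := div_pos hdel hR
  obtain ⟨ε, hε⟩ : ∃ ε, ε = (b - a ^ 2 / 4) / r 0 := ⟨_, rfl⟩
  rw [← hε] at heps
  have hmul : ε * r 0 = b - a ^ 2 / 4 := by rw [hε]; field_simp
  have key : ∀ n : ℕ, r n ≤ r 0 - n * ε := by
    intro n
    induction n with
    | zero => simp
    | succ n ih =>
      have hle : r n ≤ r 0 := by
        have : 0 ≤ (n : ℝ) * ε := by positivity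
        linarith
      have : ε ≤ r n - r (n + 1) := by
        by_contra hcon
        push Not at hcon
        have h1 := hdec n
        have h2 := mul_lt_mul_of_pos_right hcon (hpos n)
        have h3 := mul_le_mul_of_nonneg_left hle heps.le
        linarith
      push_cast
      linarith
  obtain ⟨n, hn⟩ := exists_nat_gt (r 0 / ε)
  rw [div_lt_iff₀ heps] at hn
  linarith [key n, hpos n]

theorem stmt_14 (p c : ℝ) (hp : 1 ≤ p) (hc0 : 0 ≤ c) (hc : c < Real.sqrt 8) :
    ¬ ∃ y : ℕ → ℝ, (∀ i, 0 < y i) ∧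
      ∀ i, y (i + 2) ≤ (c / Real.sqrt (p + 1) + 2) * y (i + 1) -
        (2 / (p + 1) + c / Real.sqrt (p + 1) + 1) * y i := by
  rintro ⟨y, hy, hr⟩
  refine aux_rec _ _ ?_ y hy hr
  have hp1 : 0 < p + 1 := by linarith
  have hc2 : c ^ 2 < 8 := (Real.lt_sqrt hc0).1 hc
  have e : (c / Real.sqrt (p + 1)) ^ 2 = c ^ 2 / (p + 1) := by
    rw [div_pow, Real.sq_sqrt hp1.le]
  have h3 : c ^ 2 / (p + 1) < 8 / (p + 1) := div_lt_div_of_pos_right hc2 hp1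
  have h4 : 8 / (p + 1) = 4 * (2 / (p + 1)) := by ring
  nlinarith
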